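/- Let Δ be the genus-2 metric graph consisting of two loops, of lengths L₁ > 0 and L₂ > 0, attached at vertices a and b respectively to the two endpoints of a bridge edge of length c > 0. Then: (1) the point w on the first loop at maximal distance from a (i.e., at distance L₁/2 from a along either arc of the loop) is a Weierstrass point of Δ; and (2) every point lying on the bridge edge connecting a and b is a Weierstrass point of Δ. In particular, Δ has infinitely many Weierstrass points. -/

import Mathlib

open scoped Classical

noncomputable section

/-! ## Combinatorial models of metric graphs and their topological realizations -/

/-- A combinatorial model of a metric graph: a finite multigraph with positive
edge lengths. -/
structure CombGraph : Type 1 where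
  V : Type
  E : Type
  fintypeV : Fintype V
  fintypeE : Fintype E
  src : E → V
  tgt : E → V
  len : E → ℝ
  len_pos : ∀ e, 0 < len e

attribute [instance] CombGraph.fintypeV CombGraph.fintypeE

namespace CombGraph

variable (G : CombGraph)

instance : TopologicalSpace G.V := ⊥
instance : TopologicalSpace G.E := ⊥

/-- The disjoint union of the vertices and of the edges seen as real intervals,
before gluing. -/
def Pre : Type := G.V ⊕ (G.E × ℝ)

instance : TopologicalSpace G.Pre := inferInstanceAs (TopologicalSpace (G.V ⊕ (G.E × ℝ)))

/-- The predicate selecting legitimate points: a point of an edge `e` must have its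
coordinate in `[0, len e]`. -/
def Ok : G.Pre → Prop
  | Sum.inl _ => True
  | Sum.inr p => 0 ≤ p.2 ∧ p.2 ≤ G.len p.1

/-- Points of the model before gluing. -/
def PreR : Type := {p : G.Pre // G.Ok p}

instance : TopologicalSpace G.PreR := inferInstanceAs (TopologicalSpace {p : G.Pre // G.Ok p})

/-- The gluing relation: the endpoints of each edge are glued to the corresponding
vertices. -/
inductive Glue : G.PreR → G.PreR → Prop
  | srcGlue (e : G.E) :
      Glue ⟨Sum.inl (G.src e), trivial⟩ ⟨Sum.inr (e, 0), ⟨le_refl 0, (G.len_pos e).le⟩⟩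
  | tgtGlue (e : G.E) :
      Glue ⟨Sum.inl (G.tgt e), trivial⟩ ⟨Sum.inr (e, G.len e), ⟨(G.len_pos e).le, le_refl _⟩⟩

/-- The topological realization of the combinatorial model: the underlying
topological space of the associated metric graph. -/
def Space : Type := Quot G.Glue

instance : TopologicalSpace G.Space := inferInstanceAs (TopologicalSpace (Quot G.Glue))

/-- The point of the realization corresponding to a vertex. -/
def vertexPt (v : G.V) : G.Space := Quot.mk _ ⟨Sum.inl v, trivial⟩

/-- Clamping of a real coordinate into `[0, len e]`. -/
def clamp (e : G.E) (t : ℝ) : ℝ := max 0 (min t (G.len e))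

/-- The point of the realization lying on the edge `e` at coordinate `t`
(the coordinate is clamped into `[0, len e]`). -/
def edgePt (e : G.E) (t : ℝ) : G.Space :=
  Quot.mk _ ⟨Sum.inr (e, G.clamp e t),
    ⟨le_max_left 0 _, max_le (G.len_pos e).le (min_le_right _ _)⟩⟩

/-- The genus (first Betti number) of the (connected) metric graph. -/
def genus : ℤ := (Fintype.card G.E : ℤ) - (Fintype.card G.V : ℤ) + 1

/-! ### Outgoing directions, valence -/

/-- `d = (e, b)` is an outgoing unit tangent direction at the point `x`:
if `b = true` it points in the direction of increasing coordinate on `e`, if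
`b = false` in the direction of decreasing coordinate. -/
def IsDir (x : G.Space) (d : G.E × Bool) : Prop :=
  if d.2 then ∃ t, 0 ≤ t ∧ t < G.len d.1 ∧ x = G.edgePt d.1 t
  else ∃ t, 0 < t ∧ t ≤ G.len d.1 ∧ x = G.edgePt d.1 t

/-- The (finite) set of outgoing directions at a point. -/
def dirSet (x : G.Space) : Finset (G.E × Bool) :=
  Finset.univ.filter fun d => G.IsDir x d

/-- The valence of a point of the realization: the number of outgoing
directions at that point. -/
def valence (x : G.Space) : ℕ := (G.dirSet x).card

/-- The coordinate on the edge `d.1` of a point `x` admitting `d` as an outgoing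
direction. -/
def dirCoord (x : G.Space) (d : G.E × Bool) : ℝ :=
  if d.2 then
    (if h : ∃ t, 0 ≤ t ∧ t < G.len d.1 ∧ x = G.edgePt d.1 t then h.choose else 0)
  else
    (if h : ∃ t, 0 < t ∧ t ≤ G.len d.1 ∧ x = G.edgePt d.1 t then h.choose else 0)

/-- The point at distance `u` from `x` in the outgoing direction `d`. -/
def dirPt (x : G.Space) (d : G.E × Bool) (u : ℝ) : G.Space :=
  G.edgePt d.1 (G.dirCoord x d + (if d.2 then u else -u))

end CombGraph

/-! ### Rational functions and divisors -/

/-- A function `g : [0, L] → ℝ` is piecewise integral affine if there is a finite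
subdivision of `[0, L]` on whose pieces `g` is affine with integral slope. -/
def PWIntAffine (g : ℝ → ℝ) (L : ℝ) : Prop :=
  ∃ (n : ℕ) (t : ℕ → ℝ) (m : ℕ → ℤ) (b : ℕ → ℝ),
    t 0 = 0 ∧ t n = L ∧ (∀ i, i < n → t i < t (i + 1)) ∧
    (∀ i, i < n → ∀ u, t i ≤ u → u ≤ t (i + 1) → g u = (m i : ℝ) * u + b i)

/-- A rational function on the metric graph realizing `G`: a continuous function
which is piecewise integral affine on every edge. -/
structure RatFn (G : CombGraph) where
  toFun : G.Space → ℝ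
  continuous : Continuous toFun
  piecewise : ∀ e : G.E, PWIntAffine (fun t => toFun (G.edgePt e t)) (G.len e)

namespace CombGraph

variable (G : CombGraph)

/-- The right-hand slope of a rational function on the edge `e` at coordinate `t`. -/
def rightSlope (f : RatFn G) (e : G.E) (t : ℝ) : ℝ :=
  derivWithin (fun u => f.toFun (G.edgePt e u)) (Set.Ici t) t

/-- The left-hand slope of a rational function on the edge `e` at coordinate `t`. -/
def leftSlope (f : RatFn G) (e : G.E) (t : ℝ) : ℝ :=
  derivWithin (fun u => f.toFun (G.edgePt e u)) (Set.Iic t) t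

/-- The order of a rational function at a point: the sum of its outgoing slopes. -/
def ordAt (f : RatFn G) (x : G.Space) : ℝ :=
  if h : ∃ v : G.V, x = G.vertexPt v then
    ∑ e : G.E,
      ((if G.src e = h.choose then G.rightSlope f e 0 else 0)
        + (if G.tgt e = h.choose then -(G.leftSlope f e (G.len e)) else 0))
  else if h2 : ∃ p : G.E × ℝ, 0 < p.2 ∧ p.2 < G.len p.1 ∧ x = G.edgePt p.1 p.2 then
    G.rightSlope f h2.choose.1 h2.choose.2 - G.leftSlope f h2.choose.1 h2.choose.2
  else 0

/-- The group of divisors of the metric graph: the free abelian group on the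
points of the realization. -/
abbrev Div (G : CombGraph) : Type := G.Space →₀ ℤ

/-- The degree of a divisor. -/
def degDiv (D : Div G) : ℤ := D.sum fun _ n => n

/-- A divisor is effective if all of its coefficients are nonnegative. -/
def Effective (D : Div G) : Prop := ∀ x, 0 ≤ D x

/-- `D` is the principal divisor associated to the rational function `f`. -/
def IsPrincipal (D : Div G) (f : RatFn G) : Prop := ∀ x, (D x : ℝ) = G.ordAt f x

/-- Two divisors are linearly equivalent if their difference is principal. -/
def LinEquiv (D D' : Div G) : Prop := ∃ f : RatFn G, G.IsPrincipal (D - D') f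

/-- The Baker–Norine rank of a divisor: the largest integer `k` such that for every
effective divisor `E` of degree `k` the linear system `|D - E|` is nonempty.  (For
negative `k` the condition is vacuous, so the supremum is `-1` exactly when
`|D|` is empty.) -/
def Rk (D : Div G) : ℤ :=
  sSup {k : ℤ | ∀ E : Div G, G.Effective E → G.degDiv E = k →
    ∃ E' : Div G, G.Effective E' ∧ G.LinEquiv (D - E) E'}

/-- A point of a metric graph is a Weierstrass point if `rk(g·[x]) ≥ 1`. -/
def IsWeierstrass (x : G.Space) : Prop :=
  1 ≤ G.Rk (G.genus • Finsupp.single x 1)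

/-- The canonical divisor of a metric graph. -/
def canonical : Div G :=
  ∑ v : G.V, ((G.valence (G.vertexPt v) : ℤ) - 2) • Finsupp.single (G.vertexPt v) 1

end CombGraph

/-- The dumbbell graph of genus `2`: two loops of lengths `L₁` and `L₂`, based at the
vertices `a = 0` and `b = 1`, joined by a bridge edge of length `c`.  Edge `0` is the
first loop, edge `1` the second loop and edge `2` the bridge. -/
def dumbbell (L₁ L₂ c : ℝ) (h₁ : 0 < L₁) (h₂ : 0 < L₂) (hc : 0 < c) : CombGraph where
  V := Fin 2
  E := Fin 3
  fintypeV := inferInstance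
  fintypeE := inferInstance
  src := ![0, 1, 0]
  tgt := ![0, 1, 1]
  len := ![L₁, L₂, c]
  len_pos := by
    intro e
    fin_cases e <;> simpa using ‹_›

/-- `PLOn g a b`: on `[a, b]` the function `g` is piecewise affine with integral slopes. -/
inductive PLOn (g : ℝ → ℝ) (a : ℝ) : ℝ → Prop
  | nil : PLOn g a a
  | snoc {b c : ℝ} (m : ℤ) (k : ℝ) : PLOn g a b → b < c →
      (∀ u, b ≤ u → u ≤ c → g u = (m : ℝ) * u + k) → PLOn g a c

namespace PLOn

variable {g h : ℝ → ℝ} {a b c : ℝ}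

theorem le (hg : PLOn g a b) : a ≤ b := by
  induction hg with
  | nil => exact le_rfl
  | snoc m k _ hbc _ ih => exact ih.trans hbc.le

theorem snoc_le (m : ℤ) (k : ℝ) (hg : PLOn g a b) (hbc : b ≤ c)
    (hm : ∀ u, b ≤ u → u ≤ c → g u = (m : ℝ) * u + k) : PLOn g a c := by
  rcases hbc.eq_or_lt with rfl | hlt
  · exact hg
  · exact hg.snoc m k hlt hm

theorem const (r : ℝ) (hab : a ≤ b) : PLOn (fun _ => r) a b :=
  nil.snoc_le 0 r hab (by simp)

theorem split (hg : PLOn g a c) (hab : a ≤ b) (hbc : b ≤ c) : PLOn g a b ∧ PLOn g b c := by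
  induction hg with
  | nil =>
    obtain rfl := le_antisymm hab hbc
    exact ⟨nil, nil⟩
  | @snoc b' c' m k hg' hlt hm ih =>
    rcases le_or_gt b b' with hb | hb
    · exact ⟨(ih hb).1, (ih hb).2.snoc m k hlt hm⟩
    · exact ⟨hg'.snoc m k hb fun u h1 h2 => hm u h1 (h2.trans hbc),
        nil.snoc_le m k hbc fun u h1 h2 => hm u (hb.le.trans h1) h2⟩

theorem sub (hg : PLOn g a c) (hh : PLOn h a c) : PLOn (fun t => g t - h t) a c := by
  induction hg with
  | nil => exact nil
  | @snoc b c m k hg' hlt hm ih =>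
    obtain ⟨h1, h2⟩ := hh.split hg'.le hlt.le
    have base := ih h1
    have key : ∀ d, PLOn h b d → d ≤ c → PLOn (fun t => g t - h t) a d := by
      intro d hd
      induction hd with
      | nil => exact fun _ => base
      | @snoc p q m' k' hp hpq hm' ih' =>
        intro hq
        refine (ih' (hpq.le.trans hq)).snoc (m - m') (k - k') hpq fun u hu1 hu2 => ?_
        rw [hm u (hp.le.trans hu1) (hu2.trans hq), hm' u hu1 hu2]
        push_cast
        ring
    exact key c h2 le_rfl

theorem of_pwIntAffine {L : ℝ} (hg : PWIntAffine g L) : PLOn g 0 L := by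
  obtain ⟨n, t, m, b, h0, hn, hlt, hm⟩ := hg
  have key : ∀ i, i ≤ n → PLOn g 0 (t i) := by
    intro i
    induction i with
    | zero => exact fun _ => h0 ▸ nil
    | succ i ih => exact fun hi => (ih (by omega)).snoc (m i) (b i) (hlt i hi) (hm i hi)
  exact hn ▸ key n le_rfl

theorem pwIntAffine {L : ℝ} (hg : PLOn g 0 L) : PWIntAffine g L := by
  induction hg with
  | nil => exact ⟨0, fun _ => 0, fun _ => 0, fun _ => 0, rfl, rfl, by simp, by simp⟩
  | @snoc p q m k _ hpq hm ih =>
    obtain ⟨n, t, m', b, h0, hn, hlt, hm'⟩ := ih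
    refine ⟨n + 1, fun i => if i ≤ n then t i else q, fun i => if i < n then m' i else m,
      fun i => if i < n then b i else k, by simpa using h0, by simp, fun i hi => ?_,
      fun i hi u => ?_⟩
    · rcases Nat.lt_succ_iff_lt_or_eq.1 hi with hi' | rfl
      · simpa [hi'.le, Nat.succ_le_of_lt hi'] using hlt i hi'
      · simpa [hn] using hpq
    · rcases Nat.lt_succ_iff_lt_or_eq.1 hi with hi' | rfl
      · simpa [hi', hi'.le, Nat.succ_le_of_lt hi'] using hm' i hi' u
      · simpa [hn] using hm u

end PLOn

theorem hasDerivWithinAt_Ici_of_affine {g : ℝ → ℝ} {m k t b : ℝ} (htb : t < b)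
    (hm : ∀ u, t ≤ u → u ≤ b → g u = m * u + k) : HasDerivWithinAt g m (Set.Ici t) t := by
  have h : HasDerivWithinAt (fun u => m * u + k) m (Set.Icc t b) t := by
    simpa using (((hasDerivAt_id t).const_mul m).add_const k).hasDerivWithinAt
  exact (h.congr (fun u hu => hm u hu.1 hu.2) (hm t le_rfl htb.le)).mono_of_mem_nhdsWithin
    (Icc_mem_nhdsGE htb)

theorem hasDerivWithinAt_Iic_of_affine {g : ℝ → ℝ} {m k t b : ℝ} (hbt : b < t)
    (hm : ∀ u, b ≤ u → u ≤ t → g u = m * u + k) : HasDerivWithinAt g m (Set.Iic t) t := by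
  have h : HasDerivWithinAt (fun u => m * u + k) m (Set.Icc b t) t := by
    simpa using (((hasDerivAt_id t).const_mul m).add_const k).hasDerivWithinAt
  exact (h.congr (fun u hu => hm u hu.1 hu.2) (hm t hbt.le le_rfl)).mono_of_mem_nhdsWithin
    (Icc_mem_nhdsLE hbt)

theorem derivWithin_Ici_of_affine {g : ℝ → ℝ} {m k t b : ℝ} (htb : t < b)
    (hm : ∀ u, t ≤ u → u ≤ b → g u = m * u + k) : derivWithin g (Set.Ici t) t = m :=
  (hasDerivWithinAt_Ici_of_affine htb hm).derivWithin (uniqueDiffWithinAt_Ici t)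

theorem derivWithin_Iic_of_affine {g : ℝ → ℝ} {m k t b : ℝ} (hbt : b < t)
    (hm : ∀ u, b ≤ u → u ≤ t → g u = m * u + k) : derivWithin g (Set.Iic t) t = m :=
  (hasDerivWithinAt_Iic_of_affine hbt hm).derivWithin (uniqueDiffWithinAt_Iic t)

namespace PLOn

variable {g : ℝ → ℝ} {a b : ℝ}

theorem differentiableWithinAt_Ici (hg : PLOn g a b) {t : ℝ} (hat : a ≤ t) (htb : t < b) :
    DifferentiableWithinAt ℝ g (Set.Ici t) t := by
  induction hg with
  | nil => exact absurd hat htb.not_ge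
  | @snoc p q m k _ _ hm ih =>
    rcases lt_or_ge t p with h | h
    · exact ih h
    · exact (hasDerivWithinAt_Ici_of_affine htb
        fun u h1 h2 => hm u (h.trans h1) h2).differentiableWithinAt

theorem differentiableWithinAt_Iic (hg : PLOn g a b) {t : ℝ} (hat : a < t) (htb : t ≤ b) :
    DifferentiableWithinAt ℝ g (Set.Iic t) t := by
  induction hg with
  | nil => exact absurd hat htb.not_gt
  | @snoc p q m k _ _ hm ih =>
    rcases le_or_gt t p with h | h
    · exact ih h
    · exact (hasDerivWithinAt_Iic_of_affine h
        fun u h1 h2 => hm u h1 (h2.trans htb)).differentiableWithinAt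

/-- If the slopes of a piecewise affine function never increase, then the final slope is at most
the initial one, with strict inequality as soon as the slope decreases somewhere. -/
theorem slope_antitone (hg : PLOn g a b) (hab : a < b)
    (hconc : ∀ t, a < t → t < b →
      derivWithin g (Set.Ici t) t - derivWithin g (Set.Iic t) t ≤ 0) :
    derivWithin g (Set.Iic b) b ≤ derivWithin g (Set.Ici a) a ∧
      ∀ t, a < t → t < b → derivWithin g (Set.Ici t) t - derivWithin g (Set.Iic t) t < 0 →
        derivWithin g (Set.Iic b) b < derivWithin g (Set.Ici a) a := by
  induction hg with
  | nil => exact absurd hab (lt_irrefl a)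
  | @snoc p q m k hg' hpq hm ih =>
    have hR : ∀ t, p ≤ t → t < q → derivWithin g (Set.Ici t) t = m := fun t h1 h2 =>
      derivWithin_Ici_of_affine h2 fun u h3 h4 => hm u (h1.trans h3) h4
    have hL : ∀ t, p < t → t ≤ q → derivWithin g (Set.Iic t) t = m := fun t h1 h2 =>
      derivWithin_Iic_of_affine h1 fun u h3 h4 => hm u h3 (h4.trans h2)
    rw [hL q hpq le_rfl]
    rcases hg'.le.eq_or_lt with rfl | hap
    · rw [hR a le_rfl hpq]
      refine ⟨le_rfl, fun t h1 h2 h3 => ?_⟩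
      rw [hR t h1.le h2, hL t h1 h2.le] at h3
      linarith
    · obtain ⟨i1, i2⟩ := ih hap fun t h1 h2 => hconc t h1 (h2.trans hpq)
      have hp := hconc p hap hpq
      rw [hR p le_rfl hpq] at hp
      refine ⟨by linarith, fun t h1 h2 h3 => ?_⟩
      rcases lt_trichotomy t p with h | rfl | h
      · linarith [i2 t h1 h h3]
      · rw [hR t le_rfl hpq] at h3
        linarith
      · rw [hR t h.le h2, hL t h h2.le] at h3
        linarith

end PLOn

namespace CombGraph

variable {G : CombGraph}

instance : DiscreteTopology G.V := ⟨rfl⟩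
instance : DiscreteTopology G.E := ⟨rfl⟩

theorem clamp_of_mem {e : G.E} {t : ℝ} (h0 : 0 ≤ t) (h1 : t ≤ G.len e) : G.clamp e t = t := by
  rw [clamp, min_eq_left h1, max_eq_right h0]

theorem edgePt_eq_mk {e : G.E} {t : ℝ} (h0 : 0 ≤ t) (h1 : t ≤ G.len e) :
    G.edgePt e t = Quot.mk _ ⟨Sum.inr (e, t), ⟨h0, h1⟩⟩ := by
  unfold edgePt
  congr 3
  rw [clamp_of_mem h0 h1]

theorem edgePt_zero (e : G.E) : G.edgePt e 0 = G.vertexPt (G.src e) := by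
  rw [edgePt_eq_mk le_rfl (G.len_pos e).le]
  exact (Quot.sound (Glue.srcGlue e)).symm

theorem edgePt_len (e : G.E) : G.edgePt e (G.len e) = G.vertexPt (G.tgt e) := by
  rw [edgePt_eq_mk (G.len_pos e).le le_rfl]
  exact (Quot.sound (Glue.tgtGlue e)).symm

/-- The normal form of a point: a vertex, or an interior point of an edge. -/
def normalForm : G.Space → G.V ⊕ (G.E × ℝ) :=
  Quot.lift
    (fun p => Sum.elim Sum.inl
      (fun q : G.E × ℝ => if q.2 = 0 then Sum.inl (G.src q.1)
        else if q.2 = G.len q.1 then Sum.inl (G.tgt q.1) else Sum.inr q) p.1)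
    (by
      rintro _ _ (e | e)
      · simp
      · simp [(G.len_pos e).ne'])

theorem normalForm_vertexPt (v : G.V) : normalForm (G.vertexPt v) = Sum.inl v := rfl

theorem normalForm_edgePt {e : G.E} {t : ℝ} (h0 : 0 < t) (h1 : t < G.len e) :
    normalForm (G.edgePt e t) = Sum.inr (e, t) := by
  rw [edgePt_eq_mk h0.le h1.le]
  simp [normalForm, h0.ne', h1.ne]

theorem vertexPt_inj {v w : G.V} : G.vertexPt v = G.vertexPt w ↔ v = w :=
  ⟨fun h => Sum.inl_injective (congrArg normalForm h), fun h => h ▸ rfl⟩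

theorem vertexPt_ne_edgePt (v : G.V) {e : G.E} {t : ℝ} (h0 : 0 < t) (h1 : t < G.len e) :
    G.vertexPt v ≠ G.edgePt e t := fun h => by
  simpa [normalForm_vertexPt, normalForm_edgePt h0 h1] using congrArg normalForm h

theorem edgePt_inj {e e' : G.E} {t t' : ℝ} (h0 : 0 < t) (h1 : t < G.len e)
    (h0' : 0 < t') (h1' : t' < G.len e') :
    G.edgePt e t = G.edgePt e' t' ↔ e = e' ∧ t = t' := by
  refine ⟨fun h => ?_, fun h => by rw [h.1, h.2]⟩
  simpa [normalForm_edgePt h0 h1, normalForm_edgePt h0' h1'] using congrArg normalForm h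

theorem exists_vertexPt_or_edgePt (x : G.Space) :
    (∃ v, x = G.vertexPt v) ∨ ∃ e t, 0 < t ∧ t < G.len e ∧ x = G.edgePt e t := by
  induction x using Quot.ind with
  | mk p =>
    rcases p with ⟨v | ⟨e, t⟩, hp⟩
    · exact Or.inl ⟨v, rfl⟩
    · obtain ⟨h0, h1⟩ : 0 ≤ t ∧ t ≤ G.len e := hp
      rw [← edgePt_eq_mk h0 h1]
      rcases h0.eq_or_lt with rfl | h0
      · exact Or.inl ⟨_, edgePt_zero e⟩
      rcases h1.eq_or_lt with rfl | h1
      · exact Or.inl ⟨_, edgePt_len e⟩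
      exact Or.inr ⟨e, t, h0, h1, rfl⟩

theorem ordAt_vertexPt (f : RatFn G) (v : G.V) :
    G.ordAt f (G.vertexPt v) = ∑ e : G.E, ((if G.src e = v then G.rightSlope f e 0 else 0)
      + (if G.tgt e = v then -(G.leftSlope f e (G.len e)) else 0)) := by
  have h : ∃ w : G.V, G.vertexPt v = G.vertexPt w := ⟨v, rfl⟩
  have hw : h.choose = v := (vertexPt_inj.1 h.choose_spec).symm
  rw [ordAt, dif_pos h, hw]

theorem ordAt_edgePt (f : RatFn G) {e : G.E} {t : ℝ} (h0 : 0 < t) (h1 : t < G.len e) :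
    G.ordAt f (G.edgePt e t) = G.rightSlope f e t - G.leftSlope f e t := by
  have h : ¬ ∃ v : G.V, G.edgePt e t = G.vertexPt v :=
    fun ⟨v, hv⟩ => vertexPt_ne_edgePt v h0 h1 hv.symm
  have h2 : ∃ p : G.E × ℝ, 0 < p.2 ∧ p.2 < G.len p.1 ∧ G.edgePt e t = G.edgePt p.1 p.2 :=
    ⟨(e, t), h0, h1, rfl⟩
  obtain ⟨p0, p1, p2⟩ := h2.choose_spec
  obtain ⟨q1, q2⟩ := (edgePt_inj h0 h1 p0 p1).1 p2
  rw [ordAt, dif_neg h, dif_pos h2, ← q1, ← q2]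

theorem plOn (f : RatFn G) (e : G.E) : PLOn (fun t => f.toFun (G.edgePt e t)) 0 (G.len e) :=
  .of_pwIntAffine (f.piecewise e)

/-- A rational function all of whose orders are nonpositive has all orders equal to zero. -/
theorem not_ordAt_neg_of_nonpos (f : RatFn G) (hf : ∀ z, G.ordAt f z ≤ 0) (x : G.Space) :
    ¬ G.ordAt f x < 0 := by
  intro hx
  have hedge := fun e => (plOn f e).slope_antitone (G.len_pos e) fun t h0 h1 =>
    (ordAt_edgePt f h0 h1).symm.trans_le (hf (G.edgePt e t))
  have hle : ∀ e ∈ Finset.univ, (0 : ℝ) ≤ G.rightSlope f e 0 - G.leftSlope f e (G.len e) :=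
    fun e _ => sub_nonneg.2 (hedge e).1
  have hsum : ∑ v, G.ordAt f (G.vertexPt v)
      = ∑ e, (G.rightSlope f e 0 - G.leftSlope f e (G.len e)) := by
    simp_rw [ordAt_vertexPt]
    rw [Finset.sum_comm]
    refine Finset.sum_congr rfl fun e _ => ?_
    rw [Finset.sum_add_distrib, Finset.sum_ite_eq, Finset.sum_ite_eq]
    simp [sub_eq_add_neg]
  rcases exists_vertexPt_or_edgePt x with ⟨v, rfl⟩ | ⟨e, t, h0, h1, rfl⟩
  · have h1 : ∑ v, G.ordAt f (G.vertexPt v) < 0 :=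
      Finset.sum_neg' (fun v _ => hf _) ⟨v, Finset.mem_univ _, hx⟩
    linarith [Finset.sum_nonneg hle]
  · rw [ordAt_edgePt f h0 h1] at hx
    have h2 : 0 < ∑ e, (G.rightSlope f e 0 - G.leftSlope f e (G.len e)) :=
      Finset.sum_pos' hle ⟨e, Finset.mem_univ _, sub_pos.2 ((hedge e).2 t h0 h1 hx)⟩
    have h3 : ∑ v, G.ordAt f (G.vertexPt v) ≤ 0 := Finset.sum_nonpos fun v _ => hf _
    linarith

end CombGraph

/-- The difference of two rational functions. -/
def RatFn.sub {G : CombGraph} (f g : RatFn G) : RatFn G where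
  toFun x := f.toFun x - g.toFun x
  continuous := f.continuous.sub g.continuous
  piecewise e := ((CombGraph.plOn f e).sub (CombGraph.plOn g e)).pwIntAffine

/-- A rational function prescribed by its values at the vertices and along the edges. -/
def RatFn.ofEdges {G : CombGraph} (φ : G.V → ℝ) (F : G.E → ℝ → ℝ)
    (hsrc : ∀ e, F e 0 = φ (G.src e)) (htgt : ∀ e, F e (G.len e) = φ (G.tgt e))
    (hcont : ∀ e, Continuous (F e)) (hpl : ∀ e, PLOn (F e) 0 (G.len e)) : RatFn G where
  toFun := Quot.lift (fun p => Sum.elim φ (fun q : G.E × ℝ => F q.1 q.2) p.1) (by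
    rintro _ _ (e | e)
    · exact (hsrc e).symm
    · exact (htgt e).symm)
  continuous := by
    refine continuous_quot_lift _ (Continuous.comp (g := Sum.elim φ fun q : G.E × ℝ => F q.1 q.2)
      (continuous_sum_dom.2 ⟨continuous_of_discreteTopology, ?_⟩) continuous_subtype_val)
    exact continuous_prod_of_discrete_left.2 hcont
  piecewise e := by
    have key : ∀ b, PLOn (F e) 0 b → b ≤ G.len e →
        PLOn (fun t => Sum.elim φ (fun q : G.E × ℝ => F q.1 q.2) (Sum.inr (e, G.clamp e t)))
          0 b := by
      intro b hb
      induction hb with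
      | nil => exact fun _ => .nil
      | snoc m k hp hlt hm ih =>
        intro hq
        refine (ih (hlt.le.trans hq)).snoc m k hlt fun u h1 h2 => ?_
        simpa [CombGraph.clamp_of_mem (hp.le.trans h1) (h2.trans hq)] using hm u h1 h2
    exact (key _ (hpl e) le_rfl).pwIntAffine

namespace CombGraph

variable {G : CombGraph}

theorem ofEdges_edgePt (φ : G.V → ℝ) (F : G.E → ℝ → ℝ) (hsrc htgt hcont hpl) {e : G.E} {t : ℝ}
    (h0 : 0 ≤ t) (h1 : t ≤ G.len e) :
    (RatFn.ofEdges φ F hsrc htgt hcont hpl).toFun (G.edgePt e t) = F e t := by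
  rw [edgePt_eq_mk h0 h1]
  rfl

theorem rightSlope_ofEdges (φ : G.V → ℝ) (F : G.E → ℝ → ℝ) (hsrc htgt hcont hpl) {e : G.E}
    {t b : ℝ} (m k : ℝ) (h0 : 0 ≤ t) (htb : t < b) (hb : b ≤ G.len e)
    (hm : ∀ u, t ≤ u → u ≤ b → F e u = m * u + k) :
    G.rightSlope (RatFn.ofEdges φ F hsrc htgt hcont hpl) e t = m :=
  derivWithin_Ici_of_affine htb fun u h1 h2 => by
    rw [ofEdges_edgePt _ _ _ _ _ _ (h0.trans h1) (h2.trans hb), hm u h1 h2]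

theorem leftSlope_ofEdges (φ : G.V → ℝ) (F : G.E → ℝ → ℝ) (hsrc htgt hcont hpl) {e : G.E}
    {t b : ℝ} (m k : ℝ) (hb : 0 ≤ b) (hbt : b < t) (h1 : t ≤ G.len e)
    (hm : ∀ u, b ≤ u → u ≤ t → F e u = m * u + k) :
    G.leftSlope (RatFn.ofEdges φ F hsrc htgt hcont hpl) e t = m :=
  derivWithin_Iic_of_affine hbt fun u h2 h3 => by
    rw [ofEdges_edgePt _ _ _ _ _ _ (hb.trans h2) (h3.trans h1), hm u h2 h3]

theorem rightSlope_sub (f g : RatFn G) (e : G.E) {t : ℝ} (h0 : 0 ≤ t) (h1 : t < G.len e) :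
    G.rightSlope (f.sub g) e t = G.rightSlope f e t - G.rightSlope g e t :=
  derivWithin_fun_sub ((plOn f e).differentiableWithinAt_Ici h0 h1)
    ((plOn g e).differentiableWithinAt_Ici h0 h1)

theorem leftSlope_sub (f g : RatFn G) (e : G.E) {t : ℝ} (h0 : 0 < t) (h1 : t ≤ G.len e) :
    G.leftSlope (f.sub g) e t = G.leftSlope f e t - G.leftSlope g e t :=
  derivWithin_fun_sub ((plOn f e).differentiableWithinAt_Iic h0 h1)
    ((plOn g e).differentiableWithinAt_Iic h0 h1)

theorem ordAt_sub (f g : RatFn G) (x : G.Space) :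
    G.ordAt (f.sub g) x = G.ordAt f x - G.ordAt g x := by
  rcases exists_vertexPt_or_edgePt x with ⟨v, rfl⟩ | ⟨e, t, h0, h1, rfl⟩
  · simp only [ordAt_vertexPt, ← Finset.sum_sub_distrib]
    refine Finset.sum_congr rfl fun e _ => ?_
    rw [rightSlope_sub f g e le_rfl (G.len_pos e), leftSlope_sub f g e (G.len_pos e) le_rfl]
    split_ifs <;> ring
  · rw [ordAt_edgePt _ h0 h1, ordAt_edgePt _ h0 h1, ordAt_edgePt _ h0 h1,
      rightSlope_sub f g e h0.le h1, leftSlope_sub f g e h0 h1.le]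
    ring

theorem IsPrincipal.sub {D D' : Div G} {f g : RatFn G} (hf : G.IsPrincipal D f)
    (hg : G.IsPrincipal D' g) : G.IsPrincipal (D - D') (f.sub g) := fun x => by
  rw [ordAt_sub, ← hf x, ← hg x]
  simp

/-- Two divisors to which a common divisor is linearly equivalent are linearly equivalent. -/
theorem LinEquiv.of_common {D D₁ D₂ : Div G} (h₁ : G.LinEquiv D D₁) (h₂ : G.LinEquiv D D₂) :
    G.LinEquiv D₁ D₂ := by
  obtain ⟨f, hf⟩ := h₁
  obtain ⟨g, hg⟩ := h₂
  refine ⟨g.sub f, ?_⟩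
  convert hg.sub hf using 1
  abel

theorem linEquiv_refl (D : Div G) : G.LinEquiv D D := by
  let f : RatFn G := RatFn.ofEdges (fun _ => 0) (fun _ _ => 0) (fun _ => rfl) (fun _ => rfl)
    (fun _ => continuous_const) fun e => .const 0 (G.len_pos e).le
  refine ⟨f.sub f, fun x => ?_⟩
  simp [ordAt_sub]

theorem LinEquiv.symm {D D' : Div G} (h : G.LinEquiv D D') : G.LinEquiv D' D :=
  h.of_common (linEquiv_refl D)

theorem LinEquiv.trans {D₁ D₂ D₃ : Div G} (h₁ : G.LinEquiv D₁ D₂) (h₂ : G.LinEquiv D₂ D₃) :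
    G.LinEquiv D₁ D₃ :=
  h₁.symm.of_common h₂

/-- Two points at equal distance from the base point of a loop: their sum is linearly equivalent
to twice the base point. -/
theorem linEquiv_loop_of_le_half (e : G.E) (he : G.src e = G.tgt e) {u : ℝ} (hu0 : 0 < u)
    (hu : u ≤ G.len e - u) :
    G.LinEquiv (2 • Finsupp.single (G.vertexPt (G.src e)) 1)
      (Finsupp.single (G.edgePt e u) 1 + Finsupp.single (G.edgePt e (G.len e - u)) 1) := by
  have hF0 : ∀ t, t ≤ u → min t (min u (G.len e - t)) = t := fun t h => by
    rw [min_eq_left (le_min h (by linarith))]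
  have hF1 : ∀ t, u ≤ t → t ≤ G.len e - u → min t (min u (G.len e - t)) = u := fun t h h' => by
    rw [min_eq_left (a := u) (by linarith), min_eq_right h]
  have hF2 : ∀ t, G.len e - u ≤ t → min t (min u (G.len e - t)) = G.len e - t := fun t h => by
    rw [min_eq_right (a := u) (by linarith), min_eq_right (by linarith)]
  let F : G.E → ℝ → ℝ := fun e' t => if e' = e then min t (min u (G.len e - t)) else 0
  have hFe : F e = fun t => min t (min u (G.len e - t)) := by ext t; simp [F]
  have hFne : ∀ e', e' ≠ e → F e' = fun _ => 0 := fun e' h => by ext t; simp [F, h]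
  have hsrc : ∀ e', F e' 0 = (fun _ : G.V => (0 : ℝ)) (G.src e') := fun e' => by
    by_cases h : e' = e
    · subst h; simp only [hFe]; exact hF0 0 hu0.le
    · simp [hFne e' h]
  have htgt : ∀ e', F e' (G.len e') = (fun _ : G.V => (0 : ℝ)) (G.tgt e') := fun e' => by
    by_cases h : e' = e
    · subst h; simp only [hFe]; rw [hF2 _ (by linarith)]; simp
    · simp [hFne e' h]
  have hcont : ∀ e', Continuous (F e') := fun e' => by
    by_cases h : e' = e
    · subst h; rw [hFe]; fun_prop
    · rw [hFne e' h]; exact continuous_const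
  have hpl : ∀ e', PLOn (F e') 0 (G.len e') := fun e' => by
    by_cases h : e' = e
    · subst h; rw [hFe]
      refine ((PLOn.nil.snoc_le 1 0 hu0.le fun t _ h => ?_).snoc_le 0 u hu
        fun t h h' => ?_).snoc_le (-1) (G.len e') (by linarith) fun t h _ => ?_
      · simp [hF0 t h]
      · simp [hF1 t h h']
      · rw [hF2 t h]; push_cast; ring
    · rw [hFne e' h]; exact .const 0 (G.len_pos e').le
  let f : RatFn G := RatFn.ofEdges (fun _ => 0) F hsrc htgt hcont hpl
  have hR := @rightSlope_ofEdges G (fun _ => 0) F hsrc htgt hcont hpl e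
  have hL := @leftSlope_ofEdges G (fun _ => 0) F hsrc htgt hcont hpl e
  have hRne : ∀ e' t, e' ≠ e → 0 ≤ t → t < G.len e' →
      G.rightSlope f e' t = 0 := fun e' t h h0 h1 =>
    rightSlope_ofEdges _ _ _ _ _ _ 0 0 h0 h1 le_rfl fun v _ _ => by simp [hFne e' h]
  have hLne : ∀ e' t, e' ≠ e → 0 < t → t ≤ G.len e' →
      G.leftSlope f e' t = 0 := fun e' t h h0 h1 =>
    leftSlope_ofEdges _ _ _ _ _ _ 0 0 le_rfl h0 h1 fun v _ _ => by simp [hFne e' h]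
  rw [hFe] at hR hL
  have hR0 : ∀ t, 0 ≤ t → t < u → G.rightSlope f e t = 1 := fun t h h' =>
    hR 1 0 h h' (by linarith) fun v _ h2 => by simp [hF0 v h2]
  have hR1 : ∀ t, u ≤ t → t < G.len e - u → G.rightSlope f e t = 0 := fun t h h' =>
    hR 0 u (hu0.le.trans h) h' (by linarith) fun v h1 h2 => by simp [hF1 v (h.trans h1) h2]
  have hR2 : ∀ t, G.len e - u ≤ t → t < G.len e → G.rightSlope f e t = -1 := fun t h h' =>
    hR (-1) (G.len e) (by linarith) h' le_rfl fun v h1 _ => (hF2 v (h.trans h1)).trans (by ring)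
  have hL0 : ∀ t, 0 < t → t ≤ u → G.leftSlope f e t = 1 := fun t h h' =>
    hL 1 0 le_rfl h (by linarith) fun v _ h2 => by simp [hF0 v (h2.trans h')]
  have hL1 : ∀ t, u < t → t ≤ G.len e - u → G.leftSlope f e t = 0 := fun t h h' =>
    hL 0 u hu0.le h (by linarith) fun v h1 h2 => by simp [hF1 v h1 (h2.trans h')]
  have hL2 : ∀ t, G.len e - u < t → t ≤ G.len e → G.leftSlope f e t = -1 := fun t h h' =>
    hL (-1) (G.len e) (by linarith) h h' fun v h1 _ => (hF2 v h1).trans (by ring)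
  refine ⟨f, fun x => ?_⟩
  have hlu : 0 < G.len e - u := by linarith
  have hlu' : G.len e - u < G.len e := by linarith
  have hul : u < G.len e := by linarith
  rcases exists_vertexPt_or_edgePt x with ⟨v, rfl⟩ | ⟨e', t, h0, h1, rfl⟩
  · rw [ordAt_vertexPt, Finset.sum_eq_single e]
    · rw [hR0 0 le_rfl hu0, hL2 _ hlu' le_rfl, ← he]
      simp only [Finsupp.coe_sub, Finsupp.coe_add, Finsupp.coe_smul, Pi.sub_apply, Pi.add_apply,
        Pi.smul_apply, Finsupp.single_apply, vertexPt_inj,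
        (vertexPt_ne_edgePt v hu0 hul).symm, (vertexPt_ne_edgePt v hlu hlu').symm, if_false]
      split_ifs <;> norm_num
    · intro e' _ h
      rw [hRne e' 0 h le_rfl (G.len_pos e'), hLne e' _ h (G.len_pos e') le_rfl]
      simp
    · simp
  · rw [ordAt_edgePt _ h0 h1]
    simp only [Finsupp.coe_sub, Finsupp.coe_add, Finsupp.coe_smul, Pi.sub_apply, Pi.add_apply,
      Pi.smul_apply, Finsupp.single_apply, vertexPt_ne_edgePt _ h0 h1, if_false,
      edgePt_inj hu0 hul h0 h1, edgePt_inj hlu hlu' h0 h1]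
    by_cases h : e' = e
    · subst h
      simp only [true_and]
      rcases lt_trichotomy t u with h | rfl | h
      · rw [hR0 t h0.le h, hL0 t h0 h.le, if_neg h.ne', if_neg (by linarith)]
        simp
      · rw [hL0 t h0 le_rfl, if_pos rfl]
        rcases hu.eq_or_lt with h' | h'
        · rw [hR2 t h'.ge h1, if_pos h'.symm]
          norm_num
        · rw [hR1 t le_rfl h', if_neg h'.ne']
          norm_num
      · rw [if_neg h.ne]
        rcases lt_trichotomy t (G.len e' - u) with h' | rfl | h'
        · rw [hR1 t h.le h', hL1 t h h'.le, if_neg h'.ne']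
          norm_num
        · rw [hR2 _ le_rfl h1, hL1 _ h le_rfl, if_pos rfl]
          norm_num
        · rw [hR2 t h'.le h1, hL2 t h' h1.le, if_neg h'.ne]
          norm_num
    · rw [hRne e' t h h0.le h1, hLne e' t h h0 h1.le]
      simp [Ne.symm h]

theorem linEquiv_loop (e : G.E) (he : G.src e = G.tgt e) {u : ℝ} (hu0 : 0 < u)
    (hu : u < G.len e) :
    G.LinEquiv (2 • Finsupp.single (G.vertexPt (G.src e)) 1)
      (Finsupp.single (G.edgePt e u) 1 + Finsupp.single (G.edgePt e (G.len e - u)) 1) := by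
  rcases le_total u (G.len e - u) with h | h
  · exact linEquiv_loop_of_le_half e he hu0 h
  · have := linEquiv_loop_of_le_half e he (u := G.len e - u) (by linarith) (by linarith)
    rwa [sub_sub_cancel, add_comm] at this

theorem eq_single_of_degDiv_eq_one {E : Div G} (hE : G.Effective E) (hdeg : G.degDiv E = 1) :
    ∃ y, E = Finsupp.single y 1 := by
  have hne : E.support.Nonempty := by
    rw [Finsupp.support_nonempty_iff]
    rintro rfl
    simp [degDiv] at hdeg
  obtain ⟨y, hy⟩ := hne
  have hy0 : 0 < E y := lt_of_le_of_ne (hE y) (Finsupp.mem_support_iff.1 hy).symm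
  have hs : E y + ∑ z ∈ E.support.erase y, E z = 1 := by
    rw [Finset.add_sum_erase _ _ hy]
    exact hdeg
  have hrest : 0 ≤ ∑ z ∈ E.support.erase y, E z := Finset.sum_nonneg fun z _ => hE z
  refine ⟨y, Finsupp.ext fun z => ?_⟩
  by_cases hz : y = z
  · subst hz
    rw [Finsupp.single_eq_same]
    omega
  · rw [Finsupp.single_apply, if_neg hz]
    by_contra hz0
    exact hz0 ((Finset.sum_eq_zero_iff_of_nonneg fun z _ => hE z).1 (by omega) z
      (Finset.mem_erase.2 ⟨Ne.symm hz, Finsupp.mem_support_iff.2 hz0⟩))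

/-- A multiple of a point has rank at least one as soon as every point is contained in an
effective divisor linearly equivalent to it. -/
theorem isWeierstrass_of_linEquiv {x : G.Space}
    (h : ∀ y, ∃ y', G.LinEquiv (G.genus • Finsupp.single x 1)
      (Finsupp.single y 1 + Finsupp.single y' 1)) : G.IsWeierstrass x := by
  refine le_csSup ⟨max 0 G.genus, fun k hk => ?_⟩ fun E hE hdeg => ?_
  · by_contra! hlt
    rw [max_lt_iff] at hlt
    obtain ⟨E', hE', f, hf⟩ := hk (Finsupp.single x k)
      (fun z => by rw [Finsupp.single_apply]; split_ifs <;> omega) (by simp [degDiv])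
    have hval : ∀ z, G.ordAt f z = (((if x = z then G.genus - k else 0) - E' z : ℤ) : ℝ) :=
      fun z => by
        rw [← hf z]
        congr 1
        simp only [Finsupp.coe_sub, Finsupp.coe_smul, Pi.sub_apply, Pi.smul_apply,
          Finsupp.single_apply]
        split_ifs <;> simp
    refine not_ordAt_neg_of_nonpos f (fun z => ?_) x ?_
    · rw [hval]
      have := hE' z
      norm_cast
      split_ifs <;> omega
    · rw [hval]
      have := hE' x
      norm_cast
      rw [if_pos rfl]
      omega
  · obtain ⟨y, rfl⟩ := eq_single_of_degDiv_eq_one hE hdeg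
    obtain ⟨y', f, hf⟩ := h y
    refine ⟨Finsupp.single y' 1, fun z => ?_, f, by rwa [sub_sub]⟩
    rw [Finsupp.single_apply]
    split_ifs <;> simp

/-- A point of a bridge, with multiplicity two, is linearly equivalent to twice an endpoint; the
function `χ` separates the two sides of the bridge. -/
theorem linEquiv_bridge (e : G.E) (χ : G.V → ℝ) (hχ0 : χ (G.src e) = 0) (hχ1 : χ (G.tgt e) = 1)
    (hχ : ∀ e', e' ≠ e → χ (G.src e') = χ (G.tgt e')) {s : ℝ} (hs0 : 0 ≤ s) (hs : s ≤ G.len e) :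
    G.LinEquiv (2 • Finsupp.single (G.vertexPt (G.src e)) 1)
      (2 • Finsupp.single (G.edgePt e s) 1) := by
  rcases hs0.eq_or_lt with rfl | hs0
  · rw [edgePt_zero]
    exact linEquiv_refl _
  have hst : G.src e ≠ G.tgt e := fun h => by
    rw [h, hχ1] at hχ0
    exact one_ne_zero hχ0
  let φ : G.V → ℝ := fun v => 2 * s * χ v
  let F : G.E → ℝ → ℝ := fun e' t => if e' = e then 2 * min t s else φ (G.src e')
  have hFe : F e = fun t => 2 * min t s := by ext t; simp [F]
  have hFne : ∀ e', e' ≠ e → F e' = fun _ => φ (G.src e') := fun e' h => by ext t; simp [F, h]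
  have hsrc : ∀ e', F e' 0 = φ (G.src e') := fun e' => by
    by_cases h : e' = e
    · subst h; simp [hFe, φ, hχ0, hs0.le]
    · simp [hFne e' h]
  have htgt : ∀ e', F e' (G.len e') = φ (G.tgt e') := fun e' => by
    by_cases h : e' = e
    · subst h; simp [hFe, φ, hχ1, hs]
    · simp [hFne e' h, φ, hχ e' h]
  have hcont : ∀ e', Continuous (F e') := fun e' => by
    by_cases h : e' = e
    · subst h; rw [hFe]; fun_prop
    · rw [hFne e' h]; exact continuous_const
  have hpl : ∀ e', PLOn (F e') 0 (G.len e') := fun e' => by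
    by_cases h : e' = e
    · subst h; rw [hFe]
      refine (PLOn.nil.snoc_le 2 0 hs0.le fun t _ h => ?_).snoc_le 0 (2 * s) hs fun t h _ => ?_
      · simp [h]
      · simp [h]
    · rw [hFne e' h]; exact .const _ (G.len_pos e').le
  let f : RatFn G := RatFn.ofEdges φ F hsrc htgt hcont hpl
  have hR := @rightSlope_ofEdges G φ F hsrc htgt hcont hpl e
  have hL := @leftSlope_ofEdges G φ F hsrc htgt hcont hpl e
  have hRne : ∀ e' t, e' ≠ e → 0 ≤ t → t < G.len e' →
      G.rightSlope f e' t = 0 := fun e' t h h0 h1 =>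
    rightSlope_ofEdges _ _ _ _ _ _ 0 (φ (G.src e')) h0 h1 le_rfl fun v _ _ => by simp [hFne e' h]
  have hLne : ∀ e' t, e' ≠ e → 0 < t → t ≤ G.len e' →
      G.leftSlope f e' t = 0 := fun e' t h h0 h1 =>
    leftSlope_ofEdges _ _ _ _ _ _ 0 (φ (G.src e')) le_rfl h0 h1 fun v _ _ => by simp [hFne e' h]
  rw [hFe] at hR hL
  have hR0 : ∀ t, 0 ≤ t → t < s → G.rightSlope f e t = 2 := fun t h h' =>
    hR 2 0 h h' hs fun u _ h2 => by simp [h2]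
  have hR1 : ∀ t, s ≤ t → t < G.len e → G.rightSlope f e t = 0 := fun t h h' =>
    hR 0 (2 * s) (hs0.le.trans h) h' le_rfl fun u h2 _ => by simp [h.trans h2]
  have hL0 : ∀ t, 0 < t → t ≤ s → G.leftSlope f e t = 2 := fun t h h' =>
    hL 2 0 le_rfl h (h'.trans hs) fun u _ h2 => by simp [h2.trans h']
  have hL1 : ∀ t, s < t → t ≤ G.len e → G.leftSlope f e t = 0 := fun t h h' =>
    hL 0 (2 * s) hs0.le h h' fun u h2 _ => by simp [h2]
  refine ⟨f, fun x => ?_⟩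
  simp only [Finsupp.coe_sub, Finsupp.coe_smul, Pi.sub_apply, Pi.smul_apply, Finsupp.single_apply]
  rcases exists_vertexPt_or_edgePt x with ⟨v, rfl⟩ | ⟨e', t, h0, h1, rfl⟩
  · rw [ordAt_vertexPt, Finset.sum_eq_single e]
    · rw [hR0 0 le_rfl hs0, vertexPt_inj]
      rcases hs.eq_or_lt with rfl | hs
      · rw [hL0 _ hs0 le_rfl, edgePt_len, vertexPt_inj]
        split_ifs <;> norm_num
      · rw [hL1 _ hs le_rfl, if_neg (vertexPt_ne_edgePt v hs0 hs).symm]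
        split_ifs <;> norm_num
    · intro e' _ h
      rw [hRne e' 0 h le_rfl (G.len_pos e'), hLne e' _ h (G.len_pos e') le_rfl]
      simp
    · simp
  · have hpt : G.edgePt e s = G.edgePt e' t ↔ e = e' ∧ s = t := by
      rcases hs.eq_or_lt with rfl | hs
      · rw [edgePt_len, iff_false_intro (vertexPt_ne_edgePt _ h0 h1), false_iff]
        rintro ⟨rfl, rfl⟩
        exact h1.false
      · exact edgePt_inj hs0 hs h0 h1
    rw [ordAt_edgePt _ h0 h1, if_neg (vertexPt_ne_edgePt _ h0 h1)]
    simp only [hpt]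
    by_cases h : e' = e
    · subst h
      rcases lt_trichotomy t s with h | rfl | h
      · rw [hR0 t h0.le h, hL0 t h0 h.le]
        simp [h.ne']
      · rw [hR1 t le_rfl h1, hL0 t h0 le_rfl]
        simp
      · rw [hR1 t h.le h1, hL1 t h h1.le]
        simp [h.ne]
    · rw [hRne e' t h h0.le h1, hLne e' t h h0 h1.le]
      simp [Ne.symm h]

/-- In a graph made of two loops `e₀`, `e₁` joined by a bridge `e₂`, every point is contained in an
effective divisor of degree two that is linearly equivalent to twice an endpoint of the bridge. -/
theorem exists_linEquiv_of_two_loops {e₀ e₁ e₂ : G.E} (hE : ∀ e, e = e₀ ∨ e = e₁ ∨ e = e₂)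
    (hV : ∀ v, v = G.src e₂ ∨ v = G.tgt e₂) (h₀ : G.src e₀ = G.src e₂) (h₀' : G.tgt e₀ = G.src e₂)
    (h₁ : G.src e₁ = G.tgt e₂) (h₁' : G.tgt e₁ = G.tgt e₂)
    (hbridge : ∀ s, 0 ≤ s → s ≤ G.len e₂ → G.LinEquiv
      (2 • Finsupp.single (G.vertexPt (G.src e₂)) 1) (2 • Finsupp.single (G.edgePt e₂ s) 1))
    (y : G.Space) :
    ∃ y', G.LinEquiv (2 • Finsupp.single (G.vertexPt (G.src e₂)) 1)
      (Finsupp.single y 1 + Finsupp.single y' 1) := by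
  have hab := hbridge (G.len e₂) (G.len_pos e₂).le le_rfl
  rw [edgePt_len] at hab
  rcases exists_vertexPt_or_edgePt y with ⟨v, rfl⟩ | ⟨e, t, h0, ht, rfl⟩
  · refine ⟨G.vertexPt v, ?_⟩
    rw [← two_nsmul]
    rcases hV v with rfl | rfl
    · exact linEquiv_refl _
    · exact hab
  · rcases hE e with rfl | rfl | rfl
    · exact ⟨_, h₀ ▸ linEquiv_loop e (h₀.trans h₀'.symm) h0 ht⟩
    · rw [← h₁] at hab
      exact ⟨_, hab.trans (linEquiv_loop e (h₁.trans h₁'.symm) h0 ht)⟩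
    · refine ⟨G.edgePt e t, ?_⟩
      rw [← two_nsmul]
      exact hbridge t h0.le ht.le

end CombGraph

section Dumbbell

variable (L₁ L₂ c : ℝ) (h₁ : 0 < L₁) (h₂ : 0 < L₂) (hc : 0 < c)

theorem dumbbell_genus : (dumbbell L₁ L₂ c h₁ h₂ hc).genus = 2 := by
  change (Fintype.card (Fin 3) : ℤ) - (Fintype.card (Fin 2) : ℤ) + 1 = 2
  simp

theorem dumbbell_linEquiv_bridge {s : ℝ} (hs0 : 0 ≤ s) (hs : s ≤ c) :
    (dumbbell L₁ L₂ c h₁ h₂ hc).LinEquiv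
      (2 • Finsupp.single ((dumbbell L₁ L₂ c h₁ h₂ hc).vertexPt (0 : Fin 2)) 1)
      (2 • Finsupp.single ((dumbbell L₁ L₂ c h₁ h₂ hc).edgePt (2 : Fin 3) s) 1) := by
  refine CombGraph.linEquiv_bridge (G := dumbbell L₁ L₂ c h₁ h₂ hc) (2 : Fin 3)
    (![0, 1] : Fin 2 → ℝ) rfl rfl ?_ hs0 hs
  change ∀ e : Fin 3, e ≠ 2 →
    (![0, 1] : Fin 2 → ℝ) ((![0, 1, 0] : Fin 3 → Fin 2) e) =
      (![0, 1] : Fin 2 → ℝ) ((![0, 1, 1] : Fin 3 → Fin 2) e)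
  intro e he
  fin_cases e
  · rfl
  · rfl
  · exact absurd rfl he

theorem dumbbell_isWeierstrass {x : (dumbbell L₁ L₂ c h₁ h₂ hc).Space}
    (hx : (dumbbell L₁ L₂ c h₁ h₂ hc).LinEquiv
      (2 • Finsupp.single ((dumbbell L₁ L₂ c h₁ h₂ hc).vertexPt (0 : Fin 2)) 1)
      (2 • Finsupp.single x 1)) : (dumbbell L₁ L₂ c h₁ h₂ hc).IsWeierstrass x := by
  refine CombGraph.isWeierstrass_of_linEquiv fun y => ?_
  have hE : ∀ e : Fin 3, e = 0 ∨ e = 1 ∨ e = 2 := by decide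
  have hV : ∀ v : Fin 2, v = 0 ∨ v = 1 := by decide
  obtain ⟨y', hy⟩ := CombGraph.exists_linEquiv_of_two_loops (G := dumbbell L₁ L₂ c h₁ h₂ hc)
    (e₀ := (0 : Fin 3)) (e₁ := (1 : Fin 3)) (e₂ := (2 : Fin 3)) hE hV rfl rfl rfl rfl
    (fun _ => dumbbell_linEquiv_bridge L₁ L₂ c h₁ h₂ hc) y
  refine ⟨y', ?_⟩
  rw [dumbbell_genus, show ((2 : ℤ) • Finsupp.single x (1 : ℤ)) = 2 • Finsupp.single x 1 from
    ofNat_zsmul _ 2]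
  exact hx.of_common hy

end Dumbbell

/-- Statement 17: on the genus-`2` dumbbell graph, the point of the first loop at
maximal distance from `a` (at coordinate `L₁/2` on the loop) is a Weierstrass point,
every point of the bridge edge is a Weierstrass point, and in particular there are
infinitely many Weierstrass points. -/
theorem dumbbell_weierstrass (L₁ L₂ c : ℝ) (h₁ : 0 < L₁) (h₂ : 0 < L₂) (hc : 0 < c) :
    (dumbbell L₁ L₂ c h₁ h₂ hc).genus = 2 ∧
    (dumbbell L₁ L₂ c h₁ h₂ hc).IsWeierstrass
      ((dumbbell L₁ L₂ c h₁ h₂ hc).edgePt (0 : Fin 3) (L₁ / 2)) ∧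
    (∀ t : ℝ, 0 ≤ t → t ≤ c →
      (dumbbell L₁ L₂ c h₁ h₂ hc).IsWeierstrass
        ((dumbbell L₁ L₂ c h₁ h₂ hc).edgePt (2 : Fin 3) t)) ∧
    {x : (dumbbell L₁ L₂ c h₁ h₂ hc).Space |
      (dumbbell L₁ L₂ c h₁ h₂ hc).IsWeierstrass x}.Infinite := by
  have hbridge : ∀ t : ℝ, 0 ≤ t → t ≤ c →
      (dumbbell L₁ L₂ c h₁ h₂ hc).IsWeierstrass
        ((dumbbell L₁ L₂ c h₁ h₂ hc).edgePt (2 : Fin 3) t) := fun t h h' =>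
    dumbbell_isWeierstrass L₁ L₂ c h₁ h₂ hc (dumbbell_linEquiv_bridge L₁ L₂ c h₁ h₂ hc h h')
  refine ⟨dumbbell_genus L₁ L₂ c h₁ h₂ hc, dumbbell_isWeierstrass L₁ L₂ c h₁ h₂ hc ?_, hbridge,
    Set.infinite_of_injOn_mapsTo (s := Set.Ioo 0 c) (fun t ht t' ht' h => ?_)
      (fun t ht => hbridge t ht.1.le ht.2.le) (Set.Ioo_infinite hc)⟩
  · have h := CombGraph.linEquiv_loop (G := dumbbell L₁ L₂ c h₁ h₂ hc) (0 : Fin 3) rfl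
      (u := L₁ / 2) (half_pos h₁) (half_lt_self h₁)
    have hlen : (dumbbell L₁ L₂ c h₁ h₂ hc).len (0 : Fin 3) - L₁ / 2 = L₁ / 2 := sub_half L₁
    rw [hlen, ← two_nsmul] at h
    exact h
  · exact ((CombGraph.edgePt_inj (G := dumbbell L₁ L₂ c h₁ h₂ hc) (e := (2 : Fin 3))
      (e' := (2 : Fin 3)) ht.1 ht.2 ht'.1 ht'.2).1 h).2
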